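/- Let P be an n×n real positive definite matrix, F an n×n real matrix, and c ≥ 0 a real number with P − c·I − F P Fᵀ positive semidefinite. Then for every real number r ≥ 0 and every x ∈ ℝⁿ with xᵀ P⁻¹ x ≤ r, the vector F x satisfies (F x)ᵀ P⁻¹ (F x) ≤ r; that is, every sublevel set { x : xᵀ P⁻¹ x ≤ r } of the Lyapunov function V(x) = xᵀ P⁻¹ x is forward invariant under the map x ↦ F x. -/

import Mathlib

open Matrix

/-- If `F P Fᵀ ⪯ P` with `P` positive definite, then `V(x) = xᵀ P⁻¹ x` does not increase under
`x ↦ F x`. -/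
theorem Matrix.PosDef.dotProduct_inv_mulVec_le {ι : Type*} [Fintype ι] [DecidableEq ι]
    {P F : Matrix ι ι ℝ} (hP : P.PosDef) (hF : (P - F * P * Fᵀ).PosSemidef) (x : ι → ℝ) :
    (F *ᵥ x) ⬝ᵥ (P⁻¹ *ᵥ (F *ᵥ x)) ≤ x ⬝ᵥ (P⁻¹ *ᵥ x) := by
  have hdet : IsUnit P.det := (Matrix.isUnit_iff_isUnit_det P).mp hP.isUnit
  have hcancel (v : ι → ℝ) : P *ᵥ (P⁻¹ *ᵥ v) = v := by
    rw [mulVec_mulVec, mul_nonsing_inv _ hdet, one_mulVec]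
  have hPt : Pᵀ = P := by simpa using hP.isHermitian.eq
  set w := P⁻¹ *ᵥ (F *ᵥ x)
  set u := P⁻¹ *ᵥ x
  have hPw : P *ᵥ w = F *ᵥ x := hcancel _
  have hPu : P *ᵥ u = x := hcancel _
  have hadj : x ⬝ᵥ (Fᵀ *ᵥ w) = (F *ᵥ x) ⬝ᵥ w := by
    rw [dotProduct_mulVec, vecMul_transpose]
  have hstein := hF.dotProduct_mulVec_nonneg w
  have hsq := hP.posSemidef.dotProduct_mulVec_nonneg (u - Fᵀ *ᵥ w)
  have hcross : u ⬝ᵥ (P *ᵥ (Fᵀ *ᵥ w)) = x ⬝ᵥ (Fᵀ *ᵥ w) := by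
    rw [dotProduct_mulVec, ← mulVec_transpose, hPt, hPu]
  have hquad : w ⬝ᵥ (F *ᵥ (P *ᵥ (Fᵀ *ᵥ w))) = (Fᵀ *ᵥ w) ⬝ᵥ (P *ᵥ (Fᵀ *ᵥ w)) := by
    rw [dotProduct_mulVec w F, ← mulVec_transpose]
  simp only [star_trivial, sub_mulVec, dotProduct_sub, ← mulVec_mulVec, hPw, hquad] at hstein
  simp only [star_trivial, mulVec_sub, dotProduct_sub, sub_dotProduct, hPu, hcross] at hsq
  rw [dotProduct_comm w] at hstein
  rw [dotProduct_comm u, dotProduct_comm (Fᵀ *ᵥ w) x] at hsq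
  linarith

/-- Invariance of sublevel sets of `V(x) = xᵀ P⁻¹ x` under `x ↦ F x` when
`P − c·I − F P Fᵀ ⪰ 0` with `c ≥ 0` (key step of Corollary 1). -/
theorem stmt17 (n : ℕ) (P : Matrix (Fin n) (Fin n) ℝ) (hP : P.PosDef)
    (F : Matrix (Fin n) (Fin n) ℝ) (c : ℝ) (hc : 0 ≤ c)
    (hStein : (P - c • (1 : Matrix (Fin n) (Fin n) ℝ) - F * P * Fᵀ).PosSemidef) :
    ∀ r : ℝ, 0 ≤ r → ∀ x : Fin n → ℝ, x ⬝ᵥ (P⁻¹ *ᵥ x) ≤ r →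
      (F *ᵥ x) ⬝ᵥ (P⁻¹ *ᵥ (F *ᵥ x)) ≤ r := by
  intro r _ x hx
  refine (hP.dotProduct_inv_mulVec_le ?_ x).trans hx
  convert hStein.add (PosSemidef.one.smul hc) using 1
  abel
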